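/- Let n ≥ 1 and let {φ_i ⊗ ψ_i}_{i=1}^N be a family of nonzero, mutually orthogonal product vectors in ℂ^2 ⊗ ℂ^n. Then either the vectors φ_i ⊗ ψ_i span all of ℂ^2 ⊗ ℂ^n, or there exist nonzero f ∈ ℂ^2 and g ∈ ℂ^n such that f ⊗ g is orthogonal to φ_i ⊗ ψ_i for all i = 1, …, N. In particular, there is no orthogonal Unextendible Product Basis in ℂ^2 ⊗ ℂ^n. -/

import Mathlib

open scoped ComplexConjugate

/-- The standard Hermitian inner product, conjugate-linear in the first argument. -/
noncomputable def hinner {α : Type*} [Fintype α] (x y : α → ℂ) : ℂ :=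
  ∑ a, conj (x a) * y a

/-- The product vector `φ ⊗ ψ` in `ℂ^n ⊗ ℂ^m`, identified with `Fin n × Fin m → ℂ`. -/
noncomputable def prodVec {n m : ℕ} (φ : Fin n → ℂ) (ψ : Fin m → ℂ) :
    Fin n × Fin m → ℂ :=
  fun p => φ p.1 * ψ p.2

theorem hinner_conj_symm {α : Type*} [Fintype α] (x y : α → ℂ) :
    conj (hinner x y) = hinner y x := by
  simp [hinner, mul_comm]

theorem hinner_eq_zero_symm {α : Type*} [Fintype α] {x y : α → ℂ} (h : hinner x y = 0) :
    hinner y x = 0 := by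
  rw [← hinner_conj_symm, h, map_zero]

theorem hinner_eq_dotProduct {α : Type*} [Fintype α] (x y : α → ℂ) :
    hinner x y = star x ⬝ᵥ y := rfl

theorem hinner_smul_left {α : Type*} [Fintype α] (c : ℂ) (x y : α → ℂ) :
    hinner (c • x) y = conj c * hinner x y := by
  simp [hinner, Finset.mul_sum, mul_assoc]

open scoped ComplexOrder in
theorem hinner_self_eq_zero {α : Type*} [Fintype α] {x : α → ℂ} (h : hinner x x = 0) : x = 0 :=
  dotProduct_star_self_eq_zero.mp h

theorem hinner_prodVec {n m : ℕ} (φ φ' : Fin n → ℂ) (ψ ψ' : Fin m → ℂ) :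
    hinner (prodVec φ ψ) (prodVec φ' ψ') = hinner φ φ' * hinner ψ ψ' := by
  simp only [hinner, prodVec, Fintype.sum_prod_type, Finset.sum_mul_sum, map_mul]
  exact Finset.sum_congr rfl fun i _ => Finset.sum_congr rfl fun j _ => by ring

theorem hinner_eq_zero_of_mem_span {α : Type*} [Fintype α] {S : Set (α → ℂ)} {d x : α → ℂ}
    (hS : ∀ s ∈ S, hinner d s = 0) (hx : x ∈ Submodule.span ℂ S) : hinner d x = 0 := by
  induction hx using Submodule.span_induction with
  | mem s hs => exact hS s hs
  | zero => simp [hinner]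
  | add x y _ _ hx hy => rw [hinner_eq_dotProduct, dotProduct_add, ← hinner_eq_dotProduct,
      ← hinner_eq_dotProduct, hx, hy, add_zero]
  | smul c x _ hx => rw [hinner_eq_dotProduct, dotProduct_smul, ← hinner_eq_dotProduct, hx,
      smul_zero]

theorem span_eq_top_of_hinner {α : Type*} [Fintype α] {S : Set (α → ℂ)}
    (hS : ∀ g, (∀ s ∈ S, hinner s g = 0) → g = 0) : Submodule.span ℂ S = ⊤ := by
  classical
  by_contra hne
  obtain ⟨F, hF, hle⟩ := Submodule.exists_le_ker_of_lt_top _ (lt_top_iff_ne_top.mpr hne)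
  set g : α → ℂ := fun a => conj (F (Pi.single a 1))
  have hF_eq (x : α → ℂ) : F x = hinner g x := by
    conv_lhs => rw [pi_eq_sum_univ' x]
    simp [hinner, g, mul_comm]
  have hg : g = 0 := hS g fun s hs => hinner_eq_zero_symm <| by
    rw [← hF_eq]
    exact hle (Submodule.subset_span hs)
  exact hF (LinearMap.ext fun x => by simp [hF_eq, hg, hinner])

theorem exists_eq_smul_of_hinner_eq_zero {x y z : Fin 2 → ℂ} (hx : x ≠ 0) (hy : y ≠ 0)
    (hxy : hinner x y = 0) (hxz : hinner x z = 0) : ∃ c : ℂ, z = c • y := by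
  simp only [hinner, Fin.sum_univ_two] at hxy hxz
  have hdet : y 0 * z 1 = y 1 * z 0 := by
    by_contra hne
    refine hx (funext fun i => ?_)
    have h0 : conj (x 0) * (y 0 * z 1 - y 1 * z 0) = 0 := by
      linear_combination z 1 * hxy - y 1 * hxz
    have h1 : conj (x 1) * (y 0 * z 1 - y 1 * z 0) = 0 := by
      linear_combination y 0 * hxz - z 0 * hxy
    fin_cases i <;> simp_all [sub_eq_zero]
  by_cases h0 : y 0 = 0
  · have h1 : y 1 ≠ 0 := fun h1 => hy (funext fun i => by fin_cases i <;> simp [h0, h1])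
    refine ⟨z 1 / y 1, funext fun i => ?_⟩
    fin_cases i <;> simp_all
  · refine ⟨z 0 / y 0, funext fun i => ?_⟩
    fin_cases i
    · simp [h0]
    · simp only [Fin.mk_one, Pi.smul_apply, smul_eq_mul]
      field_simp
      linear_combination hdet

theorem exists_ne_zero_hinner_eq_zero (x : Fin 2 → ℂ) (hx : x ≠ 0) :
    ∃ e : Fin 2 → ℂ, e ≠ 0 ∧ hinner x e = 0 := by
  refine ⟨![-conj (x 1), conj (x 0)], fun h => hx (funext fun i => ?_), ?_⟩
  · have h0 := congrFun h 0
    have h1 := congrFun h 1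
    fin_cases i <;> simp_all
  · simp [hinner]
    ring

theorem exists_eq_smul_add_smul {x e : Fin 2 → ℂ} (hx : x ≠ 0) (he : e ≠ 0)
    (hxe : hinner x e = 0) (w : Fin 2 → ℂ) : ∃ a b : ℂ, w = a • x + b • e := by
  have hxx : hinner x x ≠ 0 := fun h => hx (hinner_self_eq_zero h)
  obtain ⟨b, hb⟩ := exists_eq_smul_of_hinner_eq_zero (z := w - (hinner x w / hinner x x) • x)
    hx he hxe (by
      rw [hinner_eq_dotProduct x (_ - _), dotProduct_sub, dotProduct_smul, ← hinner_eq_dotProduct,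
        ← hinner_eq_dotProduct, smul_eq_mul, div_mul_cancel₀ _ hxx, sub_self])
  exact ⟨_, b, by rw [← hb, add_sub_cancel]⟩

/-- The bilinear map sending `(φ, ψ)` to `prodVec φ ψ`. -/
noncomputable def prodVecBilin (n m : ℕ) :
    (Fin n → ℂ) →ₗ[ℂ] (Fin m → ℂ) →ₗ[ℂ] (Fin n × Fin m → ℂ) :=
  LinearMap.mk₂ ℂ prodVec
    (fun _ _ _ => by ext; simp [prodVec, add_mul])
    (fun _ _ _ => by ext; simp [prodVec, mul_assoc])
    (fun _ _ _ => by ext; simp [prodVec, mul_add])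
    (fun _ _ _ => by ext; simp [prodVec, mul_left_comm])

theorem prodVecBilin_apply {n m : ℕ} (φ : Fin n → ℂ) (ψ : Fin m → ℂ) :
    prodVecBilin n m φ ψ = prodVec φ ψ := rfl

theorem prodVec_mem_of_mem_span {n m : ℕ} {V : Submodule ℂ (Fin n × Fin m → ℂ)}
    {S : Set (Fin m → ℂ)} {w : Fin n → ℂ} {x : Fin m → ℂ}
    (hS : ∀ s ∈ S, prodVec w s ∈ V) (hx : x ∈ Submodule.span ℂ S) : prodVec w x ∈ V :=
  (Submodule.span_le (p := V.comap (prodVecBilin n m w))).mpr hS hx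

theorem eq_top_of_prodVec_mem {n m : ℕ} {V : Submodule ℂ (Fin n × Fin m → ℂ)}
    (hV : ∀ w x, prodVec w x ∈ V) : V = ⊤ := by
  refine Submodule.eq_top_iff'.mpr fun v => ?_
  have hv : v = ∑ j, prodVec (fun i => v (i, j)) (Pi.single j 1) := by
    ext ⟨i, j⟩
    simp [prodVec, Finset.sum_apply, Pi.single_apply]
  rw [hv]
  exact V.sum_mem fun j _ => hV _ _

/-- If `ψ i` lies in the span of the `ψ j` with `φ j` not parallel to `φ i`, then it already lies
in the span of those with `φ j` orthogonal to `φ i`. -/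
theorem mem_span_of_hinner_eq_zero {ι : Type*} {n : ℕ} {φ : ι → Fin 2 → ℂ} {ψ : ι → Fin n → ℂ}
    (hφ : ∀ i, φ i ≠ 0)
    (horth : ∀ i j, i ≠ j → hinner (φ i) (φ j) ≠ 0 → hinner (ψ i) (ψ j) = 0)
    {i : ι} {e : Fin 2 → ℂ} (hie : hinner (φ i) e = 0)
    (hmem : ψ i ∈ Submodule.span ℂ (ψ '' {j | hinner (φ j) e ≠ 0})) :
    ψ i ∈ Submodule.span ℂ (ψ '' {j | hinner (φ i) (φ j) = 0}) := by
  set B := {j | hinner (φ i) (φ j) = 0}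
  set D := {j | hinner (φ j) e ≠ 0 ∧ hinner (φ i) (φ j) ≠ 0}
  have hsub : {j | hinner (φ j) e ≠ 0} ⊆ B ∪ D := fun j hj =>
    (em (hinner (φ i) (φ j) = 0)).imp id fun h => ⟨hj, h⟩
  have hmem' := Submodule.span_mono (Set.image_mono hsub) hmem
  rw [Set.image_union, Submodule.span_union] at hmem'
  obtain ⟨b, hb, d, hd, hbd⟩ := Submodule.mem_sup.mp hmem'
  have hDi : hinner (ψ i) d = 0 := by
    refine hinner_eq_zero_of_mem_span ?_ hd
    rintro _ ⟨j, ⟨hje, hij⟩, rfl⟩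
    exact horth i j (by rintro rfl; exact hje hie) hij
  have hDB : hinner d b = 0 := by
    refine hinner_eq_zero_of_mem_span ?_ hb
    rintro _ ⟨k, hk, rfl⟩
    refine hinner_eq_zero_symm (hinner_eq_zero_of_mem_span ?_ hd)
    rintro _ ⟨j, ⟨hje, hij⟩, rfl⟩
    refine horth k j (by rintro rfl; exact hij hk) fun hkj => hje ?_
    obtain ⟨c, hc⟩ := exists_eq_smul_of_hinner_eq_zero (hφ i) (hφ k) hk hie
    rw [← hinner_conj_symm, hc, hinner_smul_left, hkj, mul_zero, map_zero]
  have hd0 : d = 0 := by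
    apply hinner_self_eq_zero
    have h := hinner_eq_zero_symm hDi
    rwa [← hbd, hinner_eq_dotProduct, dotProduct_add, ← hinner_eq_dotProduct,
      ← hinner_eq_dotProduct, hDB, zero_add] at h
  rwa [← hbd, hd0, add_zero]

theorem stmt5 (n N : ℕ) (hn : 1 ≤ n)
    (φ : Fin N → Fin 2 → ℂ) (ψ : Fin N → Fin n → ℂ)
    (hφ : ∀ i, φ i ≠ 0) (hψ : ∀ i, ψ i ≠ 0)
    (horth : ∀ i j, i ≠ j →
      hinner (prodVec (φ i) (ψ i)) (prodVec (φ j) (ψ j)) = 0) :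
    Submodule.span ℂ (Set.range fun i => prodVec (φ i) (ψ i)) = ⊤ ∨
      ∃ (f : Fin 2 → ℂ) (g : Fin n → ℂ), f ≠ 0 ∧ g ≠ 0 ∧
        ∀ i, hinner (prodVec (φ i) (ψ i)) (prodVec f g) = 0 := by
  refine or_iff_not_imp_right.mpr fun hno => ?_
  have hspan (f : Fin 2 → ℂ) (hf : f ≠ 0) :
      Submodule.span ℂ (ψ '' {j | hinner (φ j) f ≠ 0}) = ⊤ := by
    refine span_eq_top_of_hinner fun g hg => ?_
    by_contra hg0
    refine hno ⟨f, g, hf, hg0, fun i => ?_⟩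
    rw [hinner_prodVec, mul_eq_zero]
    exact or_iff_not_imp_left.mpr fun hi => hg _ ⟨i, hi, rfl⟩
  have horth' (i j : Fin N) (hij : i ≠ j) (h : hinner (φ i) (φ j) ≠ 0) :
      hinner (ψ i) (ψ j) = 0 :=
    (mul_eq_zero.mp (hinner_prodVec _ _ _ _ ▸ horth i j hij)).resolve_left h
  set V := Submodule.span ℂ (Set.range fun i => prodVec (φ i) (ψ i))
  have hV (i : Fin N) : prodVec (φ i) (ψ i) ∈ V := Submodule.subset_span ⟨i, rfl⟩
  have hVψ (w : Fin 2 → ℂ) (i : Fin N) : prodVec w (ψ i) ∈ V := by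
    obtain ⟨e, he, hie⟩ := exists_ne_zero_hinner_eq_zero (φ i) (hφ i)
    have hmem := mem_span_of_hinner_eq_zero hφ horth' hie (hspan e he ▸ Submodule.mem_top)
    have hVe : prodVec e (ψ i) ∈ V := by
      refine prodVec_mem_of_mem_span ?_ hmem
      rintro _ ⟨k, hk, rfl⟩
      obtain ⟨c, rfl⟩ := exists_eq_smul_of_hinner_eq_zero (hφ i) (hφ k) hk hie
      rw [← prodVecBilin_apply, map_smul]
      exact V.smul_mem c (hV k)
    obtain ⟨a, b, rfl⟩ := exists_eq_smul_add_smul (hφ i) he hie w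
    rw [← prodVecBilin_apply, map_add, map_smul, map_smul]
    exact V.add_mem (V.smul_mem a (hV i)) (V.smul_mem b hVe)
  refine eq_top_of_prodVec_mem fun w x => prodVec_mem_of_mem_span (S := ψ '' _) ?_
    (hspan 1 one_ne_zero ▸ Submodule.mem_top)
  rintro _ ⟨k, -, rfl⟩
  exact hVψ w k
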